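/- Let F : C → Sets be a flat continuous functor on the scaling-site category C (category of elements cofiltered; covers sent to jointly surjective families). Assume F(V) ≠ ∅ for some bounded open interval V with 0 ∉ V. Then the set H_F^+ = {λ ∈ (0,∞) : F_λ ≠ ∅}, where F_λ is the co-stalk of F at λ, is the strictly positive part of a rank one subgroup H_F of ℝ: there is an increasing sequence of real numbers h_k > 0 with h_k/h_{k+1} ∈ ℕ_{>0}, such that H_F = ∪_k h_kℤ and H_F^+ = H_F ∩ (0,∞). In particular H_F^+ is stable under multiplication by every positive integer, and any two elements of H_F^+ have a common divisor in H_F^+ with integer ratios. -/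

import Mathlib

open CategoryTheory

/-- An object of the scaling-site category `C`: a (possibly empty) bounded open interval
`Ω ⊆ [0,∞)`. -/
structure ScObj : Type where
  s : Set ℝ
  isInterval : ∃ a b : ℝ, s = Set.Ioo a b
  nonneg : s ⊆ Set.Ici 0

/-- The scaling-site category: a morphism `Ω → Ω'` is (the action on `Ω` of) a positive
integer `n` with `nΩ ⊆ Ω'`; for `Ω = ∅` all integers give the same (empty) map, so the empty
interval is an initial object. -/
instance : Category ScObj where
  Hom Ω Ω' := {φ : Ω.s → Ω'.s // ∃ n : ℕ+, ∀ x : Ω.s, (φ x : ℝ) = (n : ℝ) * (x : ℝ)}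
  id Ω := ⟨fun x => x, 1, fun x => by simp⟩
  comp {Ω₁ Ω₂ Ω₃} f g := ⟨fun x => g.1 (f.1 x), by
    obtain ⟨n, hn⟩ := f.2
    obtain ⟨m, hm⟩ := g.2
    exact ⟨m * n, fun x => by rw [hm, hn]; push_cast; ring⟩⟩
  id_comp f := rfl
  comp_id f := rfl
  assoc f g h := rfl

/-- Continuity of a functor `F : C → Sets` on the scaling site: every cover of an interval
by open subintervals (via inclusion morphisms, i.e. those given by the integer `1`) is sent
to a jointly surjective family. -/
def ScContinuous (F : ScObj ⥤ Type) : Prop :=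
  ∀ (Ω : ScObj) (ι : Type) (U : ι → ScObj) (inc : ∀ i, U i ⟶ Ω),
    (∀ i, ∀ x : (U i).s, ((inc i).1 x : ℝ) = (x : ℝ)) →
    (⋃ i, (U i).s) = Ω.s →
    ∀ y : F.obj Ω, ∃ (i : ι) (x : F.obj (U i)), F.map (inc i) x = y

/-- The co-stalk `F_λ = lim_{λ ∈ J} F(J)` of `F` at `λ`: compatible families of elements of
`F(J)` over the open intervals `J` containing `λ`, with transition maps the inclusions. -/
def CoStalk (F : ScObj ⥤ Type) (lam : ℝ) : Type :=
  {s : ∀ J : {J : ScObj // lam ∈ J.s}, F.obj J.1 //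
    ∀ (J J' : {J : ScObj // lam ∈ J.s}) (f : J.1 ⟶ J'.1),
      (∀ x : J.1.s, (f.1 x : ℝ) = (x : ℝ)) → F.map f (s J) = s J'}

/-- The support set `H_F^+ = {λ ∈ (0,∞) : F_λ ≠ ∅}`. -/
def HFplus (F : ScObj ⥤ Type) : Set ℝ := {lam : ℝ | 0 < lam ∧ Nonempty (CoStalk F lam)}

namespace ScObj

lemma pos_of_mem {U : ScObj} {x : ℝ} (hx : x ∈ U.s) : 0 < x := by
  obtain ⟨a, b, hab⟩ := U.isInterval
  have hmem : x ∈ Set.Ioo a b := hab ▸ hx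
  have hmid : (a + x) / 2 ∈ U.s := by
    rw [hab]
    exact ⟨by linarith [hmem.1], by linarith [hmem.1, hmem.2]⟩
  have hnonneg : 0 ≤ (a + x) / 2 := U.nonneg hmid
  linarith [hmem.1]

lemma hom_ext {U W : ScObj} {f g : U ⟶ W} (h : ∀ x : U.s, (f.1 x : ℝ) = g.1 x) : f = g :=
  Subtype.ext (funext fun x => Subtype.ext (h x))

/-- Multiplication by `n`, as a morphism. -/
def mulHom (n : ℕ+) {U W : ScObj} (h : ∀ x ∈ U.s, (n : ℝ) * x ∈ W.s) : U ⟶ W :=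
  ⟨fun x => ⟨n * x, h x x.2⟩, n, fun _ => rfl⟩

/-- The inclusion of a subinterval, as a morphism. -/
def incl {U W : ScObj} (h : U.s ⊆ W.s) : U ⟶ W :=
  ⟨fun x => ⟨x, h x.2⟩, 1, fun x => by simp⟩

/-- The part of `U` at distance less than `ε` from `lam`. -/
def near (U : ScObj) (lam ε : ℝ) : ScObj where
  s := U.s ∩ Set.Ioo (lam - ε) (lam + ε)
  isInterval := by
    obtain ⟨a, b, hab⟩ := U.isInterval
    exact ⟨_, _, by rw [hab, Set.Ioo_inter_Ioo]⟩
  nonneg := Set.inter_subset_left.trans U.nonneg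

/-- The interval `nU`. -/
def scale (n : ℕ+) (U : ScObj) : ScObj where
  s := {x | x / n ∈ U.s}
  isInterval := by
    obtain ⟨a, b, hab⟩ := U.isInterval
    have hn : (0 : ℝ) < n := by exact_mod_cast n.pos
    refine ⟨a * n, b * n, ?_⟩
    ext x
    simp only [hab, Set.mem_ofPred_eq, Set.mem_Ioo, lt_div_iff₀ hn, div_lt_iff₀ hn]
  nonneg := fun x hx => by
    have hn : (0 : ℝ) < n := by exact_mod_cast n.pos
    have hpos : 0 < x / n := pos_of_mem hx
    exact ((div_pos_iff_of_pos_right hn).1 hpos).le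

lemma mul_mem_scale (n : ℕ+) {U : ScObj} {x : ℝ} (hx : x ∈ U.s) :
    (n : ℝ) * x ∈ (scale n U).s := by
  have hn : (n : ℝ) ≠ 0 := by exact_mod_cast n.ne_zero
  change (n : ℝ) * x / n ∈ U.s
  rwa [mul_div_cancel_left₀ _ hn]

lemma exists_ball_subset {U : ScObj} {lam : ℝ} (h : lam ∈ U.s) :
    ∃ ε > 0, Set.Ioo (lam - ε) (lam + ε) ⊆ U.s := by
  obtain ⟨a, b, hab⟩ := U.isInterval
  have hmem : lam ∈ Set.Ioo a b := hab ▸ h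
  refine ⟨min (lam - a) (b - lam), lt_min (sub_pos.2 hmem.1) (sub_pos.2 hmem.2), ?_⟩
  rw [hab]
  exact Set.Ioo_subset_Ioo (by linarith [min_le_left (lam - a) (b - lam)])
    (by linarith [min_le_right (lam - a) (b - lam)])

end ScObj

open ScObj

/-- The element `z` of `F(V)` lifts to arbitrarily small subintervals of `V` near `lam`. -/
def Concentrates (F : ScObj ⥤ Type) {V : ScObj} (z : F.obj V) (lam : ℝ) : Prop :=
  ∀ ε > 0, ∃ (U : ScObj) (i : U.s ⊆ V.s), U.s ⊆ Set.Ioo (lam - ε) (lam + ε) ∧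
    ∃ z' : F.obj U, F.map (incl i) z' = z

section

variable {F : ScObj ⥤ Type}

lemma ScContinuous.nonempty (hcont : ScContinuous F) {U : ScObj} (z : F.obj U) :
    U.s.Nonempty := by
  by_contra hempty
  obtain ⟨i, -⟩ := hcont U Empty (fun i => i.elim) (fun i => i.elim) (fun i => i.elim)
    (by simpa using (Set.not_nonempty_iff_eq_empty.1 hempty).symm) z
  exact i.elim

/-- Every element concentrates at some point of its interval. -/
lemma ScContinuous.exists_concentrates (hcont : ScContinuous F) {V : ScObj} (z : F.obj V) :
    ∃ lam ∈ V.s, Concentrates F z lam := by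
  by_contra! hnot
  simp only [Concentrates, not_forall] at hnot
  choose! ε hε hbad using hnot
  obtain ⟨i, x, hx⟩ := hcont V V.s (fun i => V.near i (ε i))
    (fun i => incl Set.inter_subset_left) (fun _ _ => rfl) (by
      ext y
      simp only [Set.mem_iUnion]
      refine ⟨fun ⟨_, hy⟩ => hy.1, fun hy => ⟨⟨y, hy⟩, hy, ?_⟩⟩
      have := hε y hy
      constructor <;> simp only <;> linarith) z
  exact hbad i i.2 ⟨_, Set.inter_subset_left, Set.inter_subset_right, x, hx⟩

/-- Two elements of a flat functor come from a common one. -/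
lemma exists_common_source (hflat : IsCofiltered F.Elements) {U V : ScObj} (x : F.obj U)
    (y : F.obj V) : ∃ (W : ScObj) (w : F.obj W) (f : W ⟶ U) (g : W ⟶ V),
      F.map f w = x ∧ F.map g w = y := by
  obtain ⟨W, f, g, -⟩ :=
    IsCofilteredOrEmpty.cone_objs (F.elementsMk U x) (F.elementsMk V y)
  exact ⟨W.1, W.2, f.1, g.1, f.2, g.2⟩

/-- Flatness forces a morphism between two given elements to be unique. -/
lemma hom_eq_of_map_eq (hflat : IsCofiltered F.Elements) (hcont : ScContinuous F)
    {U V : ScObj} {f g : U ⟶ V} {x : F.obj U} (h : F.map f x = F.map g x) : f = g := by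
  obtain ⟨W, a, ha⟩ := IsCofilteredOrEmpty.cone_maps
    (CategoryOfElements.homMk (F.elementsMk U x) (F.elementsMk V (F.map g x)) f h)
    (CategoryOfElements.homMk (F.elementsMk U x) (F.elementsMk V (F.map g x)) g rfl)
  have hval : a.1 ≫ f = a.1 ≫ g := congrArg Subtype.val ha
  obtain ⟨p, hp⟩ := hcont.nonempty W.2
  have hpt : f.1 (a.1.1 ⟨p, hp⟩) = g.1 (a.1.1 ⟨p, hp⟩) :=
    congrFun (congrArg Subtype.val hval) ⟨p, hp⟩
  obtain ⟨n, hn⟩ := f.2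
  obtain ⟨m, hm⟩ := g.2
  have hnm : (n : ℝ) = m := by
    have hmul := congrArg Subtype.val hpt
    rw [hn, hm] at hmul
    exact mul_right_cancel₀ (pos_of_mem (a.1.1 ⟨p, hp⟩).2).ne' hmul
  exact hom_ext fun y => by rw [hn, hm, hnm]

/-- Two lifts of an element to subintervals come from one element by the same integer. -/
lemma exists_common_lift (hflat : IsCofiltered F.Elements) (hcont : ScContinuous F)
    {V U U' : ScObj} (i : U.s ⊆ V.s) (i' : U'.s ⊆ V.s) {x : F.obj U} {x' : F.obj U'}
    (h : F.map (incl i) x = F.map (incl i') x') :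
    ∃ (W : ScObj) (w : F.obj W) (f : W ⟶ U) (g : W ⟶ U'), F.map f w = x ∧ F.map g w = x' ∧
      ∀ p : W.s, (f.1 p : ℝ) = g.1 p := by
  obtain ⟨W, w, f, g, hf, hg⟩ := exists_common_source hflat x x'
  have hfg : f ≫ incl i = g ≫ incl i' := hom_eq_of_map_eq hflat hcont (x := w) (by
    rw [F.map_comp_apply, F.map_comp_apply, hf, hg, h])
  exact ⟨W, w, f, g, hf, hg, fun p =>
    congrArg Subtype.val (congrFun (congrArg Subtype.val hfg) p)⟩

namespace Concentrates

lemma unique (hflat : IsCofiltered F.Elements) (hcont : ScContinuous F) {V : ScObj}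
    {z : F.obj V} {lam mu : ℝ} (h : Concentrates F z lam) (h' : Concentrates F z mu) :
    lam = mu := by
  by_contra hne
  have hdist : 0 < |lam - mu| / 2 := by
    have := abs_pos.2 (sub_ne_zero.2 hne)
    positivity
  obtain ⟨U, i, hU, x, hx⟩ := h _ hdist
  obtain ⟨U', i', hU', x', hx'⟩ := h' _ hdist
  obtain ⟨W, w, f, g, -, -, hfg⟩ := exists_common_lift hflat hcont i i' (hx.trans hx'.symm)
  obtain ⟨p, hp⟩ := hcont.nonempty w
  have hf := hU (f.1 ⟨p, hp⟩).2
  have hg := hU' (g.1 ⟨p, hp⟩).2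
  rw [← hfg] at hg
  exact (abs_lt.2 ⟨by linarith [hf.2, hg.1], by linarith [hf.1, hg.2]⟩ :
    |lam - mu| < |lam - mu|).false

lemma map {V W : ScObj} {w : F.obj W} {nu : ℝ} (h : Concentrates F w nu) (f : W ⟶ V) {n : ℕ+}
    (hn : ∀ x : W.s, (f.1 x : ℝ) = n * x) : Concentrates F (F.map f w) (n * nu) := by
  intro ε hε
  have hn0 : (0 : ℝ) < n := by exact_mod_cast n.pos
  obtain ⟨U, i, hU, x, hx⟩ := h (ε / n) (div_pos hε hn0)
  have hsub : (scale n U).s ⊆ V.s := fun y hy => by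
    have hval := hn ⟨y / n, i hy⟩
    simp only [mul_div_cancel₀ _ hn0.ne'] at hval
    exact hval ▸ (f.1 ⟨y / n, i hy⟩).2
  refine ⟨scale n U, hsub, fun y hy => ?_, F.map (mulHom n fun _ => mul_mem_scale n) x, ?_⟩
  · have hy' := hU hy
    rw [Set.mem_Ioo, lt_div_iff₀ hn0, div_lt_iff₀ hn0, sub_mul, add_mul,
      div_mul_cancel₀ _ hn0.ne', mul_comm nu] at hy'
    exact hy'
  · have hcomp : mulHom n (fun _ => mul_mem_scale n) ≫ incl hsub = incl i ≫ f :=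
      hom_ext fun p => (hn ⟨p, i p.2⟩).symm
    rw [← hx, ← F.map_comp_apply, ← F.map_comp_apply, hcomp]

lemma nonempty_coStalk (hflat : IsCofiltered F.Elements) (hcont : ScContinuous F) {V : ScObj}
    {z : F.obj V} {lam : ℝ} (h : Concentrates F z lam) : Nonempty (CoStalk F lam) := by
  have hex : ∀ J : {J : ScObj // lam ∈ J.s}, ∃ x : F.obj J.1, ∃ (U : ScObj) (i : U.s ⊆ V.s)
      (j : U.s ⊆ J.1.s) (z' : F.obj U), F.map (incl i) z' = z ∧ F.map (incl j) z' = x := by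
    rintro ⟨J, hJ⟩
    obtain ⟨ε, hε, hball⟩ := exists_ball_subset hJ
    obtain ⟨U, i, hU, z', hz'⟩ := h ε hε
    exact ⟨_, U, i, hU.trans hball, z', hz', rfl⟩
  choose s U i j t hi hj using hex
  refine ⟨s, fun J J' f hf => ?_⟩
  obtain ⟨W, w, a, b, ha, hb, hab⟩ :=
    exists_common_lift hflat hcont (i J) (i J') ((hi J).trans (hi J').symm)
  have hcomp : a ≫ incl (j J) ≫ f = b ≫ incl (j J') :=
    hom_ext fun p => (hf _).trans (hab p)
  rw [← hj J, ← hj J', ← ha, ← hb, ← F.map_comp_apply, ← F.map_comp_apply, ← F.map_comp_apply,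
    hcomp]

end Concentrates

lemma mem_HFplus_iff (hflat : IsCofiltered F.Elements) (hcont : ScContinuous F) {lam : ℝ} :
    lam ∈ HFplus F ↔ 0 < lam ∧ ∃ (V : ScObj) (z : F.obj V), Concentrates F z lam := by
  refine and_congr_right fun hlam => ⟨fun ⟨s, hs⟩ => ?_, fun ⟨V, z, hz⟩ =>
    hz.nonempty_coStalk hflat hcont⟩
  let V : ScObj := ⟨Set.Ioo 0 (lam + 1), ⟨_, _, rfl⟩, fun _ hx => hx.1.le⟩
  have hV : lam ∈ V.s := ⟨hlam, by simp⟩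
  refine ⟨V, s ⟨V, hV⟩, fun ε hε => ?_⟩
  have hnear : lam ∈ (V.near lam ε).s := ⟨hV, by linarith, by linarith⟩
  exact ⟨V.near lam ε, Set.inter_subset_left, Set.inter_subset_right, s ⟨_, hnear⟩,
    hs ⟨_, hnear⟩ ⟨V, hV⟩ _ fun _ => rfl⟩

lemma mul_mem_HFplus (hflat : IsCofiltered F.Elements) (hcont : ScContinuous F) {lam : ℝ}
    (h : lam ∈ HFplus F) (n : ℕ+) : (n : ℝ) * lam ∈ HFplus F := by
  rw [mem_HFplus_iff hflat hcont] at h ⊢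
  obtain ⟨hlam, V, z, hz⟩ := h
  exact ⟨mul_pos (by exact_mod_cast n.pos) hlam, scale n V, _,
    hz.map (mulHom n fun _ => mul_mem_scale n) fun _ => rfl⟩

lemma exists_common_divisor (hflat : IsCofiltered F.Elements) (hcont : ScContinuous F)
    {lam mu : ℝ} (hlam : lam ∈ HFplus F) (hmu : mu ∈ HFplus F) :
    ∃ nu ∈ HFplus F, ∃ n m : ℕ+, lam = (n : ℝ) * nu ∧ mu = (m : ℝ) * nu := by
  rw [mem_HFplus_iff hflat hcont] at hlam hmu
  obtain ⟨-, V, z, hz⟩ := hlam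
  obtain ⟨-, V', z', hz'⟩ := hmu
  obtain ⟨W, w, f, g, rfl, rfl⟩ := exists_common_source hflat z z'
  obtain ⟨nu, hnu, hw⟩ := hcont.exists_concentrates w
  obtain ⟨n, hn⟩ := f.2
  obtain ⟨m, hm⟩ := g.2
  exact ⟨nu, (mem_HFplus_iff hflat hcont).2 ⟨pos_of_mem hnu, W, w, hw⟩, n, m,
    hz.unique hflat hcont (hw.map f hn), hz'.unique hflat hcont (hw.map g hm)⟩

end

/-- A nonempty set of positive reals, stable under positive integer multiples and in which any
two elements have a common divisor, is the positive part of an increasing union of cyclic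
groups. -/
lemma exists_seq_eq_iUnion_zmultiples {H : Set ℝ} (hne : H.Nonempty) (hpos : ∀ x ∈ H, 0 < x)
    (hmul : ∀ x ∈ H, ∀ n : ℕ+, (n : ℝ) * x ∈ H)
    (hdiv : ∀ x ∈ H, ∀ y ∈ H, ∃ z ∈ H, ∃ n m : ℕ+, x = (n : ℝ) * z ∧ y = (m : ℝ) * z) :
    ∃ h : ℕ → ℝ, (∀ k, 0 < h k) ∧ (∀ k, ∃ n : ℕ+, h k = (n : ℝ) * h (k + 1)) ∧
      H = (⋃ k, {x : ℝ | ∃ m : ℤ, x = (m : ℝ) * h k}) ∩ Set.Ioi 0 := by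
  obtain ⟨x₀, hx₀⟩ := hne
  have hcount : H.Countable := by
    refine (Set.countable_range fun q : ℕ+ × ℕ+ => (q.1 : ℝ) * (x₀ / q.2)).mono fun y hy => ?_
    obtain ⟨z, -, n, m, hn, hm⟩ := hdiv x₀ hx₀ y hy
    have hn0 : (n : ℝ) ≠ 0 := by exact_mod_cast n.ne_zero
    exact ⟨(m, n), by simp only [hn, hm, mul_div_cancel_left₀ _ hn0]⟩
  obtain ⟨e, he⟩ := hcount.exists_eq_range ⟨x₀, hx₀⟩
  have heH : ∀ k, e k ∈ H := fun k => he ▸ Set.mem_range_self k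
  choose! d hd n m hn hm using hdiv
  let h : ℕ → ℝ := fun k => Nat.rec x₀ (fun k y => d y (e k)) k
  have hH : ∀ k, h k ∈ H := fun k => by
    induction k with
    | zero => exact hx₀
    | succ k ih => exact hd _ ih _ (heH k)
  refine ⟨h, fun k => hpos _ (hH k), fun k => ⟨_, hn _ (hH k) _ (heH k)⟩, ?_⟩
  ext x
  simp only [Set.mem_inter_iff, Set.mem_iUnion, Set.mem_ofPred_eq, Set.mem_Ioi]
  constructor
  · intro hx
    obtain ⟨k, rfl⟩ : x ∈ Set.range e := he ▸ hx
    exact ⟨⟨k + 1, (m (h k) (e k) : ℤ), by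
      simpa using hm _ (hH k) _ (heH k)⟩, hpos _ hx⟩
  · rintro ⟨⟨k, c, rfl⟩, hx⟩
    have hc : 0 < c := by exact_mod_cast pos_of_mul_pos_left hx (hpos _ (hH k)).le
    lift c to ℕ using hc.le
    exact_mod_cast hmul _ (hH k) ⟨c, by exact_mod_cast hc⟩

/-- STATEMENT 17: for a flat continuous functor `F` on the scaling site with `F(V) ≠ ∅` for
some interval `V` with `0 ∉ V`, the set `H_F^+ = {λ > 0 : F_λ ≠ ∅}` is the strictly positive
part of a rank one subgroup `H_F = ∪_k h_kℤ` of `ℝ` (with `h_k > 0`, `h_k/h_{k+1} ∈ ℕ_{>0}`);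
in particular `H_F^+` is stable under multiplication by positive integers and any two of its
elements have a common divisor in `H_F^+` with integer ratios. -/
theorem statement17 (F : ScObj ⥤ Type) (hflat : IsCofiltered F.Elements)
    (hcont : ScContinuous F) (V : ScObj) (h0 : (0 : ℝ) ∉ V.s) (hne : Nonempty (F.obj V)) :
    (∃ h : ℕ → ℝ, (∀ k, 0 < h k) ∧ (∀ k, ∃ n : ℕ+, h k = (n : ℝ) * h (k + 1)) ∧
        HFplus F = (⋃ k, {x : ℝ | ∃ m : ℤ, x = (m : ℝ) * h k}) ∩ Set.Ioi 0) ∧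
    (∀ lam ∈ HFplus F, ∀ n : ℕ+, (n : ℝ) * lam ∈ HFplus F) ∧
    (∀ lam ∈ HFplus F, ∀ mu ∈ HFplus F, ∃ nu ∈ HFplus F, ∃ n m : ℕ+,
        lam = (n : ℝ) * nu ∧ mu = (m : ℝ) * nu) := by
  have hmul : ∀ lam ∈ HFplus F, ∀ n : ℕ+, (n : ℝ) * lam ∈ HFplus F := fun _ hlam n =>
    mul_mem_HFplus hflat hcont hlam n
  have hdiv : ∀ lam ∈ HFplus F, ∀ mu ∈ HFplus F, ∃ nu ∈ HFplus F, ∃ n m : ℕ+,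
      lam = (n : ℝ) * nu ∧ mu = (m : ℝ) * nu := fun _ hlam _ hmu =>
    exists_common_divisor hflat hcont hlam hmu
  obtain ⟨z⟩ := hne
  obtain ⟨lam, hlam, hz⟩ := hcont.exists_concentrates z
  have hmem : lam ∈ HFplus F := (mem_HFplus_iff hflat hcont).2 ⟨pos_of_mem hlam, V, z, hz⟩
  exact ⟨exists_seq_eq_iUnion_zmultiples ⟨lam, hmem⟩ (fun _ hx => hx.1) hmul hdiv, hmul, hdiv⟩
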